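/- arXiv:2403.15893 — 2 statements merged into one kernel-verified Lean document; each statement's English description precedes it below -/
import Mathlib

section
/- Let d ≥ 2. If z₁ belongs to the backward de Sitter tube 𝒯₋ and z₂ belongs to the forward de Sitter tube 𝒯₊, then the invariant variable ζ = z₁·z₂ does not lie on the causal cut (−∞, −1]; i.e. it is not a real number ≤ −1. -/
open Finset Complex

/-- The ambient Minkowski inner product on `ℝ^{d+1}`. -/
noncomputable def minkR (n : ℕ) [NeZero n] (x y : Fin n → ℝ) : ℝ :=
  x 0 * y 0 - ∑ i ∈ Finset.univ.erase 0, x i * y i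

/-- The ambient Minkowski inner product extended `ℂ`-bilinearly to `ℂ^{d+1}`. -/
noncomputable def minkC (n : ℕ) [NeZero n] (x y : Fin n → ℂ) : ℂ :=
  x 0 * y 0 - ∑ i ∈ Finset.univ.erase 0, x i * y i

/-- The open forward cone `V₊` of the ambient space. -/
def Vplus (n : ℕ) [NeZero n] : Set (Fin n → ℝ) := {y | 0 < minkR n y y ∧ 0 < y 0}

/-- The forward tube `𝒯₊` of the complex de Sitter manifold `{z·z = −1}`. -/
def dSTplus (d : ℕ) : Set (Fin (d + 1) → ℂ) :=
  {z | minkC (d + 1) z z = -1 ∧ (fun i => (z i).im) ∈ Vplus (d + 1)}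

/-- The backward tube `𝒯₋` of the complex de Sitter manifold `{z·z = −1}`. -/
def dSTminus (d : ℕ) : Set (Fin (d + 1) → ℂ) :=
  {z | minkC (d + 1) z z = -1 ∧ (fun i => -(z i).im) ∈ Vplus (d + 1)}

/-- The real part of the complexified Minkowski product. -/
theorem minkC_re (n : ℕ) [NeZero n] (z w : Fin n → ℂ) :
    (minkC n z w).re = minkR n (fun i => (z i).re) (fun i => (w i).re)
      - minkR n (fun i => (z i).im) (fun i => (w i).im) := by
  simp only [minkC, minkR, sub_re, mul_re, re_sum, Finset.sum_sub_distrib]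
  ring

/-- The imaginary part of the complexified Minkowski product. -/
theorem minkC_im (n : ℕ) [NeZero n] (z w : Fin n → ℂ) :
    (minkC n z w).im = minkR n (fun i => (z i).re) (fun i => (w i).im)
      + minkR n (fun i => (z i).im) (fun i => (w i).re) := by
  simp only [minkC, minkR, sub_im, mul_im, im_sum, Finset.sum_add_distrib]
  ring

theorem minkR_comm (n : ℕ) [NeZero n] (x y : Fin n → ℝ) : minkR n x y = minkR n y x := by
  simp only [minkR, mul_comm]

theorem minkC_sub_self (n : ℕ) [NeZero n] (z w : Fin n → ℂ) :
    minkC n (z - w) (z - w) = minkC n z z + minkC n w w - 2 * minkC n w z := by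
  have h : ∀ i, (z i - w i) * (z i - w i) = z i * z i + w i * w i - 2 * (w i * z i) :=
    fun i => by ring
  simp only [minkC, Pi.sub_apply, h, Finset.sum_sub_distrib, Finset.sum_add_distrib,
    ← Finset.mul_sum]
  ring

theorem minkR_add_self (n : ℕ) [NeZero n] (x y : Fin n → ℝ) :
    minkR n (x + y) (x + y) = minkR n x x + minkR n y y + 2 * minkR n x y := by
  have h : ∀ i, (x i + y i) * (x i + y i) = x i * x i + y i * y i + 2 * (x i * y i) :=
    fun i => by ring
  simp only [minkR, Pi.add_apply, h, Finset.sum_add_distrib, ← Finset.mul_sum]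
  ring

/-- For timelike vectors, the spatial product is dominated by the temporal product. -/
theorem abs_spatial_lt_of_timelike (n : ℕ) [NeZero n] {x y : Fin n → ℝ}
    (hx : 0 < minkR n x x) (hy : 0 < minkR n y y) :
    |∑ i ∈ Finset.univ.erase 0, x i * y i| < |x 0 * y 0| := by
  rw [← sq_lt_sq]
  simp only [minkR, ← sq, sub_pos] at hx hy
  calc (∑ i ∈ Finset.univ.erase 0, x i * y i) ^ 2
      ≤ (∑ i ∈ Finset.univ.erase 0, x i ^ 2) * ∑ i ∈ Finset.univ.erase 0, y i ^ 2 :=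
        Finset.sum_mul_sq_le_sq_mul_sq _ _ _
    _ < x 0 ^ 2 * y 0 ^ 2 := mul_lt_mul'' hx hy (by positivity) (by positivity)
    _ = (x 0 * y 0) ^ 2 := by ring

/-- Two timelike vectors are never orthogonal. -/
theorem minkR_ne_zero_of_timelike (n : ℕ) [NeZero n] {x y : Fin n → ℝ}
    (hx : 0 < minkR n x x) (hy : 0 < minkR n y y) : minkR n x y ≠ 0 := by
  intro h
  have hlt := abs_spatial_lt_of_timelike n hx hy
  rw [← sub_eq_zero.mp h] at hlt
  exact lt_irrefl _ hlt

/-- The forward cone is closed under addition. -/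
theorem add_mem_Vplus (n : ℕ) [NeZero n] {x y : Fin n → ℝ}
    (hx : x ∈ Vplus n) (hy : y ∈ Vplus n) : x + y ∈ Vplus n := by
  refine ⟨?_, add_pos hx.2 hy.2⟩
  have hlt := abs_spatial_lt_of_timelike n hx.1 hy.1
  rw [abs_of_pos (mul_pos hx.2 hy.2)] at hlt
  have hxy : 0 < minkR n x y := sub_pos.mpr ((le_abs_self _).trans_lt hlt)
  rw [minkR_add_self]
  linarith [hx.1, hy.1]

/-- On the ambient forward tube, the Minkowski square avoids `[0, ∞)`. -/
theorem minkC_self_ne_of_im_mem_Vplus (n : ℕ) [NeZero n] {w : Fin n → ℂ}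
    (hw : (fun i => (w i).im) ∈ Vplus n) {s : ℝ} (hs : 0 ≤ s) : minkC n w w ≠ s := by
  intro h
  have hre := minkC_re n w w
  have him := minkC_im n w w
  rw [minkR_comm n (fun i => (w i).im)] at him
  rw [h, ofReal_re] at hre
  rw [h, ofReal_im] at him
  exact minkR_ne_zero_of_timelike n (x := fun i => (w i).re) (by linarith [hw.1]) hw.1
    (by linarith)

/-- For `z₁ ∈ 𝒯₋` and `z₂ ∈ 𝒯₊`, the invariant variable `ζ = z₁·z₂` avoids the causal
cut `(−∞, −1]`. -/
theorem dS_invariant_variable_avoids_cut (d : ℕ) (hd : 2 ≤ d)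
    (z₁ z₂ : Fin (d + 1) → ℂ) (h₁ : z₁ ∈ dSTminus d) (h₂ : z₂ ∈ dSTplus d) :
    ∀ r : ℝ, r ≤ -1 → minkC (d + 1) z₁ z₂ ≠ (r : ℂ) := by
  intro r hr h
  have hw : (fun i => ((z₂ - z₁) i).im) ∈ Vplus (d + 1) := by
    convert add_mem_Vplus (d + 1) h₂.2 h₁.2 using 1
    ext i
    simp [sub_eq_add_neg]
  refine minkC_self_ne_of_im_mem_Vplus (d + 1) hw (s := -2 - 2 * r) (by linarith) ?_
  rw [minkC_sub_self, h₁.1, h₂.1, h]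
  push_cast
  ring
end

section
/- Let d ≥ 2 and let a, b ∈ ℂ with a + b = 1 − d (so that the integrand is homogeneous of degree 1 − d in ξ). Let F(z₁, z₂) = ∫_{S^{d−1}} (ξ(n)·z₁)^a (ξ(n)·z₂)^b dσ(n) on T₋ × T₊ as above. Then F is invariant under the de Sitter group: for every real (d+1)×(d+1) matrix Λ preserving the ambient Minkowski bilinear form with det Λ = 1 and mapping V₊ into itself, F(Λz₁, Λz₂) = F(z₁, z₂) for all (z₁, z₂) ∈ T₋ × T₊. -/
open Finset Complex MeasureTheory

/-- The ambient past tube `T₋`. -/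
def Tminus (n : ℕ) [NeZero n] : Set (Fin n → ℂ) :=
  {z | (fun i => -(z i).im) ∈ Vplus n}

/-- The ambient future tube `T₊`. -/
def Tplus (n : ℕ) [NeZero n] : Set (Fin n → ℂ) :=
  {z | (fun i => (z i).im) ∈ Vplus n}

/-- The lightlike vector `ξ(n) = (1, n)` attached to `n ∈ ℝ^d`. -/
noncomputable def xiOf (d : ℕ) (n : EuclideanSpace ℝ (Fin d)) : Fin (d + 1) → ℂ :=
  fun i => if h : (i : ℕ) = 0 then 1
    else ((n ⟨(i : ℕ) - 1, by have := i.isLt; omega⟩ : ℝ) : ℂ)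

/-- The plane-wave integral
`F(z₁, z₂) = ∫_{S^{d−1}} (ξ(n)·z₁)^a (ξ(n)·z₂)^b dσ(n)` (principal branches). -/
noncomputable def dSPlaneWaveIntegral (d : ℕ) (a b : ℂ)
    (z₁ z₂ : Fin (d + 1) → ℂ) : ℂ :=
  ∫ n : Metric.sphere (0 : EuclideanSpace ℝ (Fin d)) 1,
    minkC (d + 1) (xiOf d (n : EuclideanSpace ℝ (Fin d))) z₁ ^ a *
      minkC (d + 1) (xiOf d (n : EuclideanSpace ℝ (Fin d))) z₂ ^ b
    ∂((volume : Measure (EuclideanSpace ℝ (Fin d))).toSphere)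

theorem lintegral_eq_lintegral_toSphere_volumeIoiPow {E : Type*} [NormedAddCommGroup E]
    [NormedSpace ℝ E] [MeasurableSpace E] [BorelSpace E] [FiniteDimensional ℝ E] [Nontrivial E]
    (μ : Measure E) [μ.IsAddHaarMeasure] {F : E → ENNReal} (hF : Measurable F) :
    ∫⁻ x, F x ∂μ = ∫⁻ n : Metric.sphere (0 : E) 1, ∫⁻ r : Set.Ioi (0 : ℝ),
      F ((r : ℝ) • (n : E)) ∂(Measure.volumeIoiPow (Module.finrank ℝ E - 1)) ∂μ.toSphere := by
  have hmp := (μ.measurePreserving_homeomorphUnitSphereProd).symm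
    (homeomorphUnitSphereProd E).toMeasurableEquiv
  calc ∫⁻ x, F x ∂μ = ∫⁻ x in {0}ᶜ, F x ∂μ := by rw [restrict_compl_singleton]
    _ = ∫⁻ x : ({0}ᶜ : Set E), F x ∂(μ.comap (↑)) :=
        (lintegral_subtype_comap (measurableSet_singleton _).compl F).symm
    _ = ∫⁻ p, F ((p.2 : ℝ) • (p.1 : E))
        ∂μ.toSphere.prod (Measure.volumeIoiPow (Module.finrank ℝ E - 1)) := by
        rw [← hmp.lintegral_comp_emb (MeasurableEquiv.measurableEmbedding _)]
        simp
    _ = _ := lintegral_prod _ (by fun_prop)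

theorem toSphere_eq_map_withDensity {E : Type*} [NormedAddCommGroup E]
    [NormedSpace ℝ E] [MeasurableSpace E] [BorelSpace E] [FiniteDimensional ℝ E] [Nontrivial E]
    (μ : Measure E) [μ.IsAddHaarMeasure] {φ : E → E} {φ' : E → E →L[ℝ] E}
    (hφm : Measurable φ) (hφ : ∀ r : ℝ, 0 < r → ∀ x, φ (r • x) = r • φ x)
    (hinj : Set.InjOn φ {0}ᶜ) (himg : φ '' {0}ᶜ = {0}ᶜ)
    (hφ' : ∀ x, x ≠ 0 → HasFDerivAt φ (φ' x) x)
    (hdet : ∀ x, x ≠ 0 → |(φ' x).det| = ‖φ x‖ / ‖x‖)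
    {g : Metric.sphere (0 : E) 1 → Metric.sphere (0 : E) 1} (hgm : Measurable g)
    (hg : ∀ n, (g n : E) = ‖φ n‖⁻¹ • φ n) :
    μ.toSphere = Measure.map g (μ.toSphere.withDensity fun n =>
      ((‖φ n‖ ^ (Module.finrank ℝ E - 1))⁻¹.toNNReal : NNReal)) := by
  have hpos : 0 < Module.finrank ℝ E := Module.finrank_pos
  obtain ⟨k, hk⟩ : ∃ k, Module.finrank ℝ E = k + 1 := ⟨_, (Nat.sub_add_cancel hpos).symm⟩
  have hne : ∀ n : Metric.sphere (0 : E) 1, (n : E) ≠ 0 := fun n =>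
    Metric.ne_of_mem_sphere n.2 one_ne_zero
  have hφne : ∀ x : E, x ≠ 0 → φ x ≠ 0 := fun x hx =>
    himg.subset (Set.mem_image_of_mem φ hx)
  have hnorm : ∀ n : Metric.sphere (0 : E) 1, ‖(n : E)‖ = 1 := by simp
  ext A hA
  set A' : Set E := Subtype.val '' A
  have hA'm : MeasurableSet A' :=
    (MeasurableEmbedding.subtype_coe Metric.isClosed_sphere.measurableSet).measurableSet_image.2 hA
  have hmem : ∀ n : Metric.sphere (0 : E) 1, (n : E) ∈ A' ↔ n ∈ A := fun n =>
    Subtype.val_injective.mem_set_image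
  set C : Set E := {x | ‖x‖ < 1 ∧ ‖x‖⁻¹ • x ∈ A'} with hC
  have hCm : MeasurableSet C :=
    (measurableSet_lt measurable_norm measurable_const).inter
      ((by fun_prop : Measurable fun x : E => ‖x‖⁻¹ • x) hA'm)
  have hcone : ∀ (n : Metric.sphere (0 : E) 1) (r s : ℝ), 0 < r → 0 < s →
      ((r • s • (n : E)) ∈ C ↔ r < s⁻¹ ∧ n ∈ A) := by
    intro n r s hr hs
    have h1 : ‖r • s • (n : E)‖ = r * s := by
      rw [norm_smul, norm_smul, hnorm, mul_one, Real.norm_of_nonneg hr.le,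
        Real.norm_of_nonneg hs.le]
    have h2 : (r * s)⁻¹ • r • s • (n : E) = n := by
      rw [smul_smul, smul_smul, mul_assoc, inv_mul_cancel₀ (by positivity), one_smul]
    simp only [hC, Set.mem_ofPred_eq, h1, h2, hmem]
    rw [← lt_div_iff₀ hs, one_div]
  have hradial : ∀ (n : Metric.sphere (0 : E) 1) (s : ℝ), 0 < s →
      ∫⁻ r : Set.Ioi (0 : ℝ), C.indicator 1 ((r : ℝ) • s • (n : E)) ∂(Measure.volumeIoiPow k)
        = A.indicator (fun _ => ENNReal.ofReal (s⁻¹ ^ (k + 1) / (k + 1))) n := by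
    intro n s hs
    by_cases hn : n ∈ A
    · rw [Set.indicator_of_mem hn, ← Measure.volumeIoiPow_apply_Iio k ⟨s⁻¹, inv_pos.2 hs⟩,
        ← lintegral_indicator_one measurableSet_Iio]
      refine lintegral_congr fun r => ?_
      have : (r : ℝ) • s • (n : E) ∈ C ↔ r ∈ Set.Iio ⟨s⁻¹, inv_pos.2 hs⟩ := by
        rw [hcone n r s r.2 hs, Set.mem_Iio, ← Subtype.coe_lt_coe]
        simp [hn]
      by_cases h : r ∈ Set.Iio ⟨s⁻¹, inv_pos.2 hs⟩
      · rw [Set.indicator_of_mem (this.2 h), Set.indicator_of_mem h, Pi.one_apply, Pi.one_apply]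
      · rw [Set.indicator_of_notMem (mt this.1 h), Set.indicator_of_notMem h]
    · rw [Set.indicator_of_notMem hn, ← lintegral_zero]
      refine lintegral_congr fun r => Set.indicator_of_notMem ?_ _
      rw [hcone n r s r.2 hs]
      exact fun h => hn h.2
  have hvol : μ C = μ.toSphere A * ENNReal.ofReal (1 / (k + 1)) := by
    rw [← lintegral_indicator_one hCm,
      lintegral_eq_lintegral_toSphere_volumeIoiPow μ (measurable_one.indicator hCm), hk,
      Nat.add_sub_cancel, mul_comm, ← lintegral_indicator_const hA]
    refine lintegral_congr fun n => ?_
    simpa using hradial n 1 one_pos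
  have hvol' : μ C = (∫⁻ n, (g ⁻¹' A).indicator (fun n =>
      ENNReal.ofReal ((‖φ n‖ ^ k)⁻¹)) n ∂μ.toSphere) * ENNReal.ofReal (1 / (k + 1)) := by
    have hCφ : Measurable fun x => C.indicator (1 : E → ENNReal) (φ x) :=
      (measurable_one.indicator hCm).comp hφm
    calc μ C = ∫⁻ x in {0}ᶜ, C.indicator 1 x ∂μ := by
          rw [restrict_compl_singleton, lintegral_indicator_one hCm]
      _ = ∫⁻ x in {0}ᶜ, ENNReal.ofReal |(φ' x).det| * C.indicator 1 (φ x) ∂μ := by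
          conv_lhs => rw [← himg]
          exact lintegral_image_eq_lintegral_abs_det_fderiv_mul μ
            (measurableSet_singleton _).compl (fun x hx => (hφ' x hx).hasFDerivWithinAt) hinj _
      _ = ∫⁻ x, ENNReal.ofReal (‖φ x‖ / ‖x‖) * C.indicator 1 (φ x) ∂μ := by
          rw [setLIntegral_congr_fun (measurableSet_singleton _).compl
            (fun x hx => by rw [hdet x hx]), restrict_compl_singleton]
      _ = ∫⁻ n, (g ⁻¹' A).indicator (fun n => ENNReal.ofReal ((‖φ n‖ ^ k)⁻¹)) n
            * ENNReal.ofReal (1 / (k + 1)) ∂μ.toSphere := by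
          rw [lintegral_eq_lintegral_toSphere_volumeIoiPow μ (by fun_prop), hk,
            Nat.add_sub_cancel]
          refine lintegral_congr fun n => ?_
          have hρ : 0 < ‖φ n‖ := norm_pos_iff.2 (hφne n (hne n))
          have hφn : φ n = ‖φ n‖ • (g n : E) := by
            rw [hg, smul_smul, mul_inv_cancel₀ hρ.ne', one_smul]
          have : ∀ r : Set.Ioi (0 : ℝ),
              ENNReal.ofReal (‖φ ((r : ℝ) • (n : E))‖ / ‖(r : ℝ) • (n : E)‖)
                * C.indicator 1 (φ ((r : ℝ) • (n : E)))
              = ENNReal.ofReal ‖φ n‖ * C.indicator 1 ((r : ℝ) • ‖φ n‖ • (g n : E)) := by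
            intro r
            have hr : (0 : ℝ) < r := r.2
            rw [hφ r hr, ← hφn, norm_smul, norm_smul, hnorm, mul_one,
              mul_div_cancel_left₀ _ (norm_ne_zero_iff.2 hr.ne')]
          simp_rw [this]
          rw [lintegral_const_mul' _ _ ENNReal.ofReal_ne_top, hradial _ _ hρ]
          by_cases hn : g n ∈ A
          · rw [Set.indicator_of_mem hn, Set.indicator_of_mem (show n ∈ g ⁻¹' A from hn),
              ← ENNReal.ofReal_mul hρ.le, ← ENNReal.ofReal_mul (by positivity)]
            congr 1
            rw [inv_pow, pow_succ]
            field_simp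
          · rw [Set.indicator_of_notMem hn,
              Set.indicator_of_notMem (show n ∉ g ⁻¹' A from hn), mul_zero, zero_mul]
      _ = _ := lintegral_mul_const' _ _ ENNReal.ofReal_ne_top
  rw [Measure.map_apply hgm hA, withDensity_apply _ (hgm hA), ← lintegral_indicator (hgm hA), hk,
    Nat.add_sub_cancel]
  rw [hvol, ENNReal.mul_left_inj (by simp; positivity) ENNReal.ofReal_ne_top] at hvol'
  exact hvol'

theorem integral_toSphere_comp_of_homogeneous {E : Type*} [NormedAddCommGroup E]
    [NormedSpace ℝ E] [MeasurableSpace E] [BorelSpace E] [FiniteDimensional ℝ E] [Nontrivial E]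
    (μ : Measure E) [μ.IsAddHaarMeasure] {φ : E → E} {φ' : E → E →L[ℝ] E}
    (hφm : Measurable φ) (hφ : ∀ r : ℝ, 0 < r → ∀ x, φ (r • x) = r • φ x)
    (hinj : Set.InjOn φ {0}ᶜ) (himg : φ '' {0}ᶜ = {0}ᶜ)
    (hφ' : ∀ x, x ≠ 0 → HasFDerivAt φ (φ' x) x)
    (hdet : ∀ x, x ≠ 0 → |(φ' x).det| = ‖φ x‖ / ‖x‖)
    {f : E → ℂ} (hfm : Measurable f)
    (hf : ∀ r : ℝ, 0 < r → ∀ x, f (r • x) = (r ^ (Module.finrank ℝ E - 1))⁻¹ • f x) :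
    ∫ n : Metric.sphere (0 : E) 1, f (φ n) ∂μ.toSphere
      = ∫ n : Metric.sphere (0 : E) 1, f n ∂μ.toSphere := by
  have hρ : ∀ n : Metric.sphere (0 : E) 1, 0 < ‖φ n‖ := fun n => norm_pos_iff.2 <|
    himg.subset (Set.mem_image_of_mem φ (Metric.ne_of_mem_sphere n.2 one_ne_zero))
  let g : Metric.sphere (0 : E) 1 → Metric.sphere (0 : E) 1 := fun n =>
    ⟨‖φ n‖⁻¹ • φ n, by simp [norm_smul, (hρ n).ne']⟩
  have hgm : Measurable g := Measurable.subtype_mk (by fun_prop)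
  have hfs : Measurable fun n : Metric.sphere (0 : E) 1 => f n :=
    hfm.comp measurable_subtype_coe
  conv_rhs => rw [toSphere_eq_map_withDensity μ hφm hφ hinj himg hφ' hdet hgm (fun _ => rfl)]
  rw [integral_map hgm.aemeasurable hfs.aestronglyMeasurable,
    integral_withDensity_eq_integral_smul (by fun_prop)]
  refine integral_congr_ae (.of_forall fun n => ?_)
  have hφn : φ n = ‖φ n‖ • (g n : E) := by
    rw [smul_smul, mul_inv_cancel₀ (hρ n).ne', one_smul]
  simp only
  conv_lhs => rw [hφn, hf _ (hρ n)]
  rw [NNReal.smul_def, Real.coe_toNNReal _ (by positivity)]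

theorem minkR_eq_sum_succ (d : ℕ) (x y : Fin (d + 1) → ℝ) :
    minkR (d + 1) x y = x 0 * y 0 - ∑ i : Fin d, x i.succ * y i.succ := by
  rw [minkR, Finset.sum_erase_eq_sub (Finset.mem_univ _), Fin.sum_univ_succ]
  ring

theorem minkC_ofReal_left (d : ℕ) (x : Fin (d + 1) → ℝ) (z : Fin (d + 1) → ℂ) :
    minkC (d + 1) (fun i => (x i : ℂ)) z =
      (minkR (d + 1) x fun i => (z i).re : ℝ) + (minkR (d + 1) x fun i => (z i).im : ℝ) * I := by
  apply Complex.ext <;> simp [minkC, minkR]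

/-- The forward lightlike vector `(‖x‖, x)`. -/
noncomputable def lightLift {d : ℕ} (x : EuclideanSpace ℝ (Fin d)) : Fin (d + 1) → ℝ :=
  Fin.cons ‖x‖ x.ofLp

@[simp]
theorem lightLift_zero {d : ℕ} (x : EuclideanSpace ℝ (Fin d)) : lightLift x 0 = ‖x‖ := rfl

@[simp]
theorem lightLift_succ {d : ℕ} (x : EuclideanSpace ℝ (Fin d)) (i : Fin d) :
    lightLift x i.succ = x i := rfl

theorem lightLift_smul {d : ℕ} {r : ℝ} (hr : 0 ≤ r) (x : EuclideanSpace ℝ (Fin d)) :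
    lightLift (r • x) = r • lightLift x := by
  ext i
  refine Fin.cases ?_ (fun i => ?_) i <;> simp [norm_smul, abs_of_nonneg hr]

theorem measurable_lightLift {d : ℕ} :
    Measurable (lightLift : EuclideanSpace ℝ (Fin d) → Fin (d + 1) → ℝ) := by
  refine measurable_pi_iff.2 (Fin.cases ?_ fun i => ?_)
  · exact measurable_norm
  · simp only [lightLift_succ]
    fun_prop

theorem minkR_lightLift_self {d : ℕ} (x : EuclideanSpace ℝ (Fin d)) :
    minkR (d + 1) (lightLift x) (lightLift x) = 0 := by
  simp [minkR_eq_sum_succ, ← sq, EuclideanSpace.real_norm_sq_eq]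

theorem eq_lightLift {d : ℕ} {w : Fin (d + 1) → ℝ} (hw : minkR (d + 1) w w = 0) (h0 : 0 ≤ w 0) :
    w = lightLift (WithLp.toLp 2 fun i : Fin d => w i.succ) := by
  ext i
  refine Fin.cases ?_ (fun i => ?_) i
  · rw [minkR_eq_sum_succ, sub_eq_zero] at hw
    rw [lightLift_zero, ← sq_eq_sq₀ h0 (norm_nonneg _), EuclideanSpace.real_norm_sq_eq, sq, hw]
    simp only [sq]
  · rfl

/-- The action on the spatial part of the forward light cone. -/
noncomputable def coneMap {d : ℕ} (Λ : Matrix (Fin (d + 1)) (Fin (d + 1)) ℝ)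
    (x : EuclideanSpace ℝ (Fin d)) : EuclideanSpace ℝ (Fin d) :=
  WithLp.toLp 2 fun i => Λ.mulVec (lightLift x) i.succ

theorem coneMap_smul {d : ℕ} (Λ : Matrix (Fin (d + 1)) (Fin (d + 1)) ℝ) {r : ℝ} (hr : 0 ≤ r)
    (x : EuclideanSpace ℝ (Fin d)) : coneMap Λ (r • x) = r • coneMap Λ x := by
  ext i
  simp [coneMap, lightLift_smul hr, Matrix.mulVec_smul]

theorem measurable_coneMap {d : ℕ} (Λ : Matrix (Fin (d + 1)) (Fin (d + 1)) ℝ) :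
    Measurable (coneMap Λ) := by
  have := @measurable_lightLift d
  unfold coneMap Matrix.mulVec dotProduct
  fun_prop

theorem lightLift_coneMap {d : ℕ} {Λ : Matrix (Fin (d + 1)) (Fin (d + 1)) ℝ}
    (hΛ : ∀ x y : Fin (d + 1) → ℝ,
      minkR (d + 1) (Λ.mulVec x) (Λ.mulVec y) = minkR (d + 1) x y)
    (hΛV : ∀ y ∈ Vplus (d + 1), Λ.mulVec y ∈ Vplus (d + 1)) (x : EuclideanSpace ℝ (Fin d)) :
    lightLift (coneMap Λ x) = Λ.mulVec (lightLift x) := by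
  have hmem : ∀ (x : EuclideanSpace ℝ (Fin d)) (ε : ℝ), 0 < ε →
      lightLift x + ε • Pi.single 0 1 ∈ Vplus (d + 1) := by
    intro x ε hε
    have := EuclideanSpace.real_norm_sq_eq x
    have hx := norm_nonneg x
    refine ⟨?_, ?_⟩
    · simp only [minkR_eq_sum_succ, Pi.add_apply, Pi.smul_apply, Pi.single_eq_same, lightLift_zero,
        lightLift_succ, Pi.single_eq_of_ne (Fin.succ_ne_zero _), smul_eq_mul, mul_one, mul_zero,
        add_zero, ← sq, ← this]
      nlinarith
    · simp only [Pi.add_apply, Pi.smul_apply, Pi.single_eq_same, lightLift_zero, smul_eq_mul]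
      linarith
  have h00 : 0 < Λ 0 0 := by
    have h0 : lightLift (0 : EuclideanSpace ℝ (Fin d)) = 0 := by
      simpa using lightLift_smul le_rfl (0 : EuclideanSpace ℝ (Fin d))
    simpa [h0] using (hΛV _ (hmem 0 1 one_pos)).2
  refine (eq_lightLift ((hΛ _ _).trans (minkR_lightLift_self x)) ?_).symm
  by_contra! hneg
  have := (hΛV _ (hmem x (-(Λ.mulVec (lightLift x) 0) / Λ 0 0)
    (div_pos (neg_pos.2 hneg) h00))).2
  rw [Matrix.mulVec_add, Matrix.mulVec_smul] at this
  simp [h00.ne'] at this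

theorem lightLift_injective {d : ℕ} :
    Function.Injective (lightLift : EuclideanSpace ℝ (Fin d) → Fin (d + 1) → ℝ) := by
  intro x y h
  ext i
  simpa using congrFun h i.succ

theorem coneMap_injective {d : ℕ} {Λ : Matrix (Fin (d + 1)) (Fin (d + 1)) ℝ}
    (hΛ : ∀ x y : Fin (d + 1) → ℝ,
      minkR (d + 1) (Λ.mulVec x) (Λ.mulVec y) = minkR (d + 1) x y)
    (hdet : Λ.det = 1)
    (hΛV : ∀ y ∈ Vplus (d + 1), Λ.mulVec y ∈ Vplus (d + 1)) :
    Function.Injective (coneMap Λ) := by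
  intro x y h
  have := congrArg lightLift h
  rw [lightLift_coneMap hΛ hΛV, lightLift_coneMap hΛ hΛV] at this
  exact lightLift_injective (Matrix.mulVec_injective_of_isUnit
    ((Matrix.isUnit_iff_isUnit_det _).2 (by simp [hdet])) this)

theorem coneMap_image_compl_zero {d : ℕ} {Λ : Matrix (Fin (d + 1)) (Fin (d + 1)) ℝ}
    (hΛ : ∀ x y : Fin (d + 1) → ℝ,
      minkR (d + 1) (Λ.mulVec x) (Λ.mulVec y) = minkR (d + 1) x y)
    (hdet : Λ.det = 1)
    (hΛV : ∀ y ∈ Vplus (d + 1), Λ.mulVec y ∈ Vplus (d + 1)) :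
    coneMap Λ '' {0}ᶜ = {0}ᶜ := by
  have h0 : coneMap Λ 0 = 0 := by simpa using coneMap_smul Λ le_rfl 0
  have hsurj : Function.Surjective (coneMap Λ) := by
    intro y
    by_cases hy : y = 0
    · exact ⟨0, by rw [h0, hy]⟩
    set w := Λ⁻¹.mulVec (lightLift y) with hw
    have hΛw : Λ.mulVec w = lightLift y := by
      rw [hw, Matrix.mulVec_mulVec, Matrix.mul_nonsing_inv _ (by simp [hdet]), Matrix.one_mulVec]
    have hnull : minkR (d + 1) w w = 0 := by
      rw [← hΛ, hΛw, minkR_lightLift_self]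
    rcases le_total 0 (w 0) with h | h
    · have hw' := eq_lightLift hnull h
      refine ⟨WithLp.toLp 2 fun i : Fin d => w i.succ, lightLift_injective ?_⟩
      rw [lightLift_coneMap hΛ hΛV, ← hw', hΛw]
    · have hw' := eq_lightLift (w := -w) (by simpa [minkR] using hnull) (by simpa using h)
      have := congrFun (lightLift_coneMap hΛ hΛV
        (WithLp.toLp 2 fun i : Fin d => (-w) i.succ)) 0
      rw [← hw', Matrix.mulVec_neg, hΛw, lightLift_zero, Pi.neg_apply, lightLift_zero] at this
      exact absurd (norm_le_zero_iff.1 (by linarith [norm_nonneg (coneMap Λ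
        (WithLp.toLp 2 fun i : Fin d => (-w) i.succ))])) hy
  rw [Set.image_compl_eq ⟨coneMap_injective hΛ hdet hΛV, hsurj⟩, Set.image_singleton, h0]

/-- The Jacobian matrix of `coneMap Λ`. -/
noncomputable def coneJacobian {d : ℕ} (Λ : Matrix (Fin (d + 1)) (Fin (d + 1)) ℝ)
    (x : EuclideanSpace ℝ (Fin d)) : Matrix (Fin d) (Fin d) ℝ :=
  Matrix.of fun i j => Λ i.succ 0 * (x j / ‖x‖) + Λ i.succ j.succ

theorem hasFDerivAt_coneMap {d : ℕ} (Λ : Matrix (Fin (d + 1)) (Fin (d + 1)) ℝ)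
    {x : EuclideanSpace ℝ (Fin d)} (hx : x ≠ 0) :
    HasFDerivAt (coneMap Λ)
      (Matrix.toEuclideanCLM (n := Fin d) (𝕜 := ℝ) (coneJacobian Λ x)) x := by
  have hx' : ‖x‖ ≠ 0 := norm_ne_zero_iff.2 hx
  have hnorm : HasFDerivAt (fun y : EuclideanSpace ℝ (Fin d) => ‖y‖) (‖x‖⁻¹ • innerSL ℝ x) x := by
    have := (hasStrictFDerivAt_norm_sq x).hasFDerivAt.sqrt (by positivity)
    simp only [Real.sqrt_sq (norm_nonneg _)] at this
    refine this.congr_fderiv ?_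
    ext v
    simp only [_root_.smul_apply, innerSL_apply_apply, smul_eq_mul, nsmul_eq_mul]
    push_cast
    field_simp
  have h1 := (hnorm.smul_const (WithLp.toLp 2 fun i : Fin d => Λ i.succ 0)).add
    (Matrix.toEuclideanCLM (n := Fin d) (𝕜 := ℝ) (Λ.submatrix Fin.succ Fin.succ)).hasFDerivAt
  refine (h1.congr_fderiv ?_).congr_of_eventuallyEq (.of_forall fun y => ?_)
  · ext v i
    simp [Matrix.mulVec, dotProduct, coneJacobian, add_mul, Finset.sum_add_distrib,
      PiLp.inner_apply, Finset.mul_sum, Finset.sum_mul]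
    refine Finset.sum_congr rfl fun j _ => ?_
    ring
  · ext i
    simp [coneMap, Matrix.mulVec, dotProduct, Fin.sum_univ_succ, mul_comm]

/-- The elementary upper triangular matrix with first row `(1, w)`. -/
noncomputable def rowShear {d : ℕ} (w : Fin d → ℝ) : Matrix (Fin (d + 1)) (Fin (d + 1)) ℝ :=
  Matrix.of (Fin.cons (Fin.cons 1 w) fun i => Pi.single i.succ 1)

theorem det_rowShear {d : ℕ} (w : Fin d → ℝ) : (rowShear w).det = 1 := by
  have h : (rowShear w).submatrix Fin.succ Fin.succ = 1 := by
    ext i j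
    simp [rowShear, Matrix.one_apply, Pi.single_apply, eq_comm]
  rw [Matrix.det_succ_column_zero, Fin.sum_univ_succ]
  simp [h]
  simp [rowShear]

theorem det_coneJacobian {d : ℕ} {Λ : Matrix (Fin (d + 1)) (Fin (d + 1)) ℝ}
    (hΛ : ∀ x y : Fin (d + 1) → ℝ,
      minkR (d + 1) (Λ.mulVec x) (Λ.mulVec y) = minkR (d + 1) x y)
    (hdet : Λ.det = 1)
    (hΛV : ∀ y ∈ Vplus (d + 1), Λ.mulVec y ∈ Vplus (d + 1))
    {x : EuclideanSpace ℝ (Fin d)} (hx : x ≠ 0) (hy : coneMap Λ x ≠ 0) :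
    (coneJacobian Λ x).det = ‖coneMap Λ x‖ / ‖x‖ := by
  have hx' : ‖x‖ ≠ 0 := norm_ne_zero_iff.2 hx
  set y := coneMap Λ x with hydef
  have hy' : ‖y‖ ≠ 0 := norm_ne_zero_iff.2 hy
  have hrow : ∀ j, ‖y‖ * Λ 0 j - ∑ i : Fin d, y i * Λ i.succ j
      = minkR (d + 1) (lightLift x) (Pi.single j 1) := by
    intro j
    rw [← hΛ, ← lightLift_coneMap hΛ hΛV, minkR_eq_sum_succ]
    simp [hydef]
  set N := rowShear (fun j => -(y j / ‖y‖)) * Λ * rowShear (fun j => x j / ‖x‖) with hN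
  have hNdet : N.det = 1 := by
    simp [hN, Matrix.det_mul, det_rowShear, hdet]
  have hP0 : ∀ j, (rowShear (fun j => -(y j / ‖y‖)) * Λ) 0 j
      = minkR (d + 1) (lightLift x) (Pi.single j 1) / ‖y‖ := by
    intro j
    rw [← hrow]
    simp [Matrix.mul_apply, rowShear, Fin.sum_univ_succ]
    rw [sub_div, mul_div_cancel_left₀ _ hy', ← sub_eq_add_neg, Finset.sum_div]
    simp only [div_mul_eq_mul_div]
  have hPs : ∀ i j, (rowShear (fun j => -(y j / ‖y‖)) * Λ) (Fin.succ i) j = Λ i.succ j := by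
    intro i j
    simp [Matrix.mul_apply, rowShear, Pi.single_apply]
  have hN00 : N 0 0 = ‖x‖ / ‖y‖ := by
    rw [hN, Matrix.mul_apply, Fin.sum_univ_succ]
    simp only [hP0]
    simp [minkR_eq_sum_succ, rowShear]
  have hN0 : ∀ j : Fin d, N 0 j.succ = 0 := by
    intro j
    rw [hN, Matrix.mul_apply, Fin.sum_univ_succ]
    simp only [hP0]
    simp [minkR_eq_sum_succ, rowShear, Pi.single_apply]
    field_simp
    ring
  have hNs : N.submatrix Fin.succ Fin.succ = coneJacobian Λ x := by
    ext i j
    rw [Matrix.submatrix_apply, hN, Matrix.mul_apply, Fin.sum_univ_succ]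
    simp only [hPs]
    simp [rowShear, Pi.single_apply, coneJacobian]
  rw [Matrix.det_succ_row_zero, Fin.sum_univ_succ] at hNdet
  simp [hN00, hN0, hNs] at hNdet
  field_simp at hNdet ⊢
  linarith

theorem xiOf_eq_lightLift {d : ℕ} (n : Metric.sphere (0 : EuclideanSpace ℝ (Fin d)) 1) :
    xiOf d (n : EuclideanSpace ℝ (Fin d)) =
      fun i => (lightLift (n : EuclideanSpace ℝ (Fin d)) i : ℂ) := by
  ext i
  refine Fin.cases ?_ (fun i => ?_) i <;> simp [xiOf]

theorem minkC_mulVec {d : ℕ} {Λ : Matrix (Fin (d + 1)) (Fin (d + 1)) ℝ}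
    (hΛ : ∀ x y : Fin (d + 1) → ℝ,
      minkR (d + 1) (Λ.mulVec x) (Λ.mulVec y) = minkR (d + 1) x y)
    (x : Fin (d + 1) → ℝ) (z : Fin (d + 1) → ℂ) :
    minkC (d + 1) (fun i => (Λ.mulVec x i : ℂ)) ((Λ.map Complex.ofReal).mulVec z)
      = minkC (d + 1) (fun i => (x i : ℂ)) z := by
  have hre : (fun i => ((Λ.map Complex.ofReal).mulVec z i).re) = Λ.mulVec fun i => (z i).re := by
    ext i; simp [Matrix.mulVec, dotProduct]
  have him : (fun i => ((Λ.map Complex.ofReal).mulVec z i).im) = Λ.mulVec fun i => (z i).im := by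
    ext i; simp [Matrix.mulVec, dotProduct]
  rw [minkC_ofReal_left, minkC_ofReal_left, hre, him, hΛ, hΛ]

theorem ofReal_mul_cpow_of_pos {r : ℝ} (hr : 0 < r) (w a : ℂ) :
    ((r : ℂ) * w) ^ a = (r : ℂ) ^ a * w ^ a := by
  by_cases hw : w = 0
  · by_cases ha : a = 0 <;> simp [hw, ha]
  have hr' : (r : ℂ) ≠ 0 := by exact_mod_cast hr.ne'
  rw [cpow_def_of_ne_zero (mul_ne_zero hr' hw), cpow_def_of_ne_zero hr', cpow_def_of_ne_zero hw,
    log_ofReal_mul hr hw, ofReal_log hr.le, add_mul, exp_add]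

/-- When `a + b = 1 − d` (integrand homogeneous of degree `1 − d` in `ξ`), the
plane-wave integral is invariant under the de Sitter group. -/
theorem dS_plane_wave_integral_invariant (d : ℕ) (hd : 2 ≤ d) (a b : ℂ)
    (hab : a + b = 1 - (d : ℂ))
    (Λ : Matrix (Fin (d + 1)) (Fin (d + 1)) ℝ)
    (hΛ : ∀ x y : Fin (d + 1) → ℝ,
      minkR (d + 1) (Λ.mulVec x) (Λ.mulVec y) = minkR (d + 1) x y)
    (hdet : Λ.det = 1)
    (hΛV : ∀ y ∈ Vplus (d + 1), Λ.mulVec y ∈ Vplus (d + 1)) :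
    ∀ z₁ ∈ Tminus (d + 1), ∀ z₂ ∈ Tplus (d + 1),
      dSPlaneWaveIntegral d a b ((Λ.map Complex.ofReal).mulVec z₁)
          ((Λ.map Complex.ofReal).mulVec z₂)
        = dSPlaneWaveIntegral d a b z₁ z₂ := by
  intro z₁ _ z₂ _
  have : Nontrivial (EuclideanSpace ℝ (Fin d)) := by
    rw [← Module.finrank_pos_iff (R := ℝ), finrank_euclideanSpace_fin]
    omega
  have himg := coneMap_image_compl_zero hΛ hdet hΛV
  have hne : ∀ x, x ≠ 0 → coneMap Λ x ≠ 0 := fun x hx => himg.subset (Set.mem_image_of_mem _ hx)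
  set w₁ := (Λ.map Complex.ofReal).mulVec z₁ with hw₁
  set w₂ := (Λ.map Complex.ofReal).mulVec z₂ with hw₂
  let f : EuclideanSpace ℝ (Fin d) → ℂ := fun x =>
    minkC (d + 1) (fun i => (lightLift x i : ℂ)) w₁ ^ a *
      minkC (d + 1) (fun i => (lightLift x i : ℂ)) w₂ ^ b
  have hfm : Measurable f := by
    have := @measurable_lightLift d
    simp only [f, minkC]
    fun_prop
  have hsmul : ∀ (r : ℝ), 0 < r → ∀ (x : EuclideanSpace ℝ (Fin d)) (w : Fin (d + 1) → ℂ),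
      minkC (d + 1) (fun i => (lightLift (r • x) i : ℂ)) w
        = r * minkC (d + 1) (fun i => (lightLift x i : ℂ)) w := by
    intro r hr x w
    simp only [minkC, lightLift_smul hr.le]
    simp [mul_sub, Finset.mul_sum, mul_assoc]
  have hf : ∀ r : ℝ, 0 < r → ∀ x, f (r • x) =
      (r ^ (Module.finrank ℝ (EuclideanSpace ℝ (Fin d)) - 1))⁻¹ • f x := by
    intro r hr x
    have hr' : (r : ℂ) ≠ 0 := by exact_mod_cast hr.ne'
    have hpow : (r : ℂ) ^ a * (r : ℂ) ^ b = ((r ^ (d - 1))⁻¹ : ℝ) := by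
      rw [← cpow_add _ _ hr', hab, ← neg_sub, cpow_neg, ← Nat.cast_one,
        ← Nat.cast_sub (by omega), cpow_natCast]
      push_cast
      rfl
    rw [finrank_euclideanSpace_fin, real_smul, ← hpow]
    simp only [f, hsmul r hr, ofReal_mul_cpow_of_pos hr]
    ring
  have key := integral_toSphere_comp_of_homogeneous
    (volume : Measure (EuclideanSpace ℝ (Fin d))) (measurable_coneMap Λ)
    (fun r hr x => coneMap_smul Λ hr.le x) (coneMap_injective hΛ hdet hΛV).injOn himg
    (fun x hx => hasFDerivAt_coneMap Λ hx)
    (fun x hx => by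
      rw [ContinuousLinearMap.det, Matrix.coe_toEuclideanCLM_eq_toEuclideanLin,
        Matrix.toEuclideanLin, Matrix.toLpLin_eq_toLin, LinearMap.det_toLin,
        det_coneJacobian hΛ hdet hΛV hx (hne x hx), abs_of_nonneg (by positivity)]) hfm hf
  simp only [dSPlaneWaveIntegral, xiOf_eq_lightLift]
  rw [← key]
  simp only [f, lightLift_coneMap hΛ hΛV, hw₁, hw₂, minkC_mulVec hΛ]
end
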